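/- arXiv:2302.06438 — 10 statements merged into one kernel-verified Lean document; each statement's English description precedes it below -/
import Mathlib

section
/- Let g > 0, 0 < ν ≤ 1, η > 0, q_w ≠ 0, r > 0, and set c = q_w²/(2r²), P^S(h) = g h³ − η h² + c, P^E(h) = g ν h³ − η h² + c, and h^Q = |q_w|/(r·√(2η)). Suppose h^E ∈ (0, 2η/(3gν)] is a root of P^E and h^S ∈ (0, 2η/(3g)] is a root of P^S. Then 0 < h^Q < h^E ≤ h^S ≤ 2η/(3g). -/
/-- The cubic `a h³ - η h² + c` is strictly decreasing on `(0, 2η/(3a)]`. -/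
theorem depth_cubic_strictAntiOn {a η : ℝ} (c : ℝ) (ha : 0 < a) :
    StrictAntiOn (fun h : ℝ => a * h ^ 3 - η * h ^ 2 + c) (Set.Ioc 0 (2 * η / (3 * a))) := by
  rintro x ⟨hx, -⟩ y ⟨hy, hy'⟩ hxy
  rw [le_div_iff₀ (by positivity)] at hy'
  have hbound : (x + y) * (y * (3 * a)) ≤ (x + y) * (2 * η) :=
    mul_le_mul_of_nonneg_left hy' (by positivity)
  have hpos : 0 < a * ((y - x) * (y + 2 * x)) :=
    mul_pos ha (mul_pos (sub_pos.2 hxy) (by positivity))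
  have hfactor : 0 < η * (x + y) - a * (x ^ 2 + x * y + y ^ 2) := by linarith
  have hdiff := mul_pos (sub_pos.2 hxy) hfactor
  change a * y ^ 3 - η * y ^ 2 + c < a * x ^ 3 - η * x ^ 2 + c
  linarith

/-- If the comparison polynomial `-η h² + q²/(2r²)` is negative at `h > 0`, then its positive
root lies below `h`. -/
theorem comparison_root_lt {η q r h : ℝ} (hη : 0 < η) (hr : 0 < r) (hh : 0 < h)
    (hneg : q ^ 2 / (2 * r ^ 2) < η * h ^ 2) : |q| / (r * Real.sqrt (2 * η)) < h := by
  rw [div_lt_iff₀ (by positivity)]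
  refine abs_lt_of_sq_lt_sq ?_ (by positivity)
  rw [div_lt_iff₀ (by positivity)] at hneg
  rw [mul_pow, mul_pow, Real.sq_sqrt (by positivity)]
  linarith


/-- Ordering of the water depths: if `h^E` is a root of `P^E` in `(0, 2η/(3gν)]`
and `h^S` a root of `P^S` in `(0, 2η/(3g)]`, then
`0 < h^Q < h^E ≤ h^S ≤ 2η/(3g)` where `h^Q = |q_w|/(r√(2η))`. -/
theorem depth_ordering (g ν η q_w r hE hS : ℝ)
    (hg : 0 < g) (hν0 : 0 < ν) (hν1 : ν ≤ 1) (hη : 0 < η)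
    (hq : q_w ≠ 0) (hr : 0 < r)
    (hEmem : hE ∈ Set.Ioc (0 : ℝ) (2 * η / (3 * g * ν)))
    (hEroot : g * ν * hE ^ 3 - η * hE ^ 2 + q_w ^ 2 / (2 * r ^ 2) = 0)
    (hSmem : hS ∈ Set.Ioc (0 : ℝ) (2 * η / (3 * g)))
    (hSroot : g * hS ^ 3 - η * hS ^ 2 + q_w ^ 2 / (2 * r ^ 2) = 0) :
    0 < |q_w| / (r * Real.sqrt (2 * η)) ∧
    |q_w| / (r * Real.sqrt (2 * η)) < hE ∧
    hE ≤ hS ∧ hS ≤ 2 * η / (3 * g) := by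
  have ha : 0 < g * ν := mul_pos hg hν0
  have hE3 : 0 < g * ν * hE ^ 3 := mul_pos ha (pow_pos hEmem.1 3)
  refine ⟨by positivity, comparison_root_lt hη hr hEmem.1 (by linarith), ?_, hSmem.2⟩
  by_contra! hlt
  have hanti := depth_cubic_strictAntiOn (η := η) (q_w ^ 2 / (2 * r ^ 2)) ha
    ⟨hSmem.1, hlt.le.trans (by simpa only [mul_assoc] using hEmem.2)⟩
    (by simpa only [mul_assoc] using hEmem) hlt
  have hcoef : g * ν * hS ^ 3 ≤ g * hS ^ 3 :=
    mul_le_mul_of_nonneg_right (mul_le_of_le_one_right hg.le hν1) (pow_pos hSmem.1 3).le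
  simp only at hanti
  linarith
end

section
/- Let g > 0, 0 < ν < 1, η > 0, c > 0, P^S(h) = g h³ − η h² + c and P^E(h) = g ν h³ − η h² + c. If h^E ∈ (0, 2η/(3gν)) is a root of P^E and h^S ∈ (0, 2η/(3g)) is a root of P^S, then h^E < h^S (strict inequality). -/
/-- Statement (2) of the Proposition: when `0 < ν < 1`, the root `h^E` of `P^E`
in `(0, 2η/(3gν))` is strictly smaller than the root `h^S` of `P^S` in
`(0, 2η/(3g))`. -/
theorem depth_strict_ordering (g ν η c hE hS : ℝ)
    (hg : 0 < g) (hν0 : 0 < ν) (hν1 : ν < 1) (hη : 0 < η) (hc : 0 < c)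
    (hEmem : hE ∈ Set.Ioo (0 : ℝ) (2 * η / (3 * g * ν)))
    (hEroot : g * ν * hE ^ 3 - η * hE ^ 2 + c = 0)
    (hSmem : hS ∈ Set.Ioo (0 : ℝ) (2 * η / (3 * g)))
    (hSroot : g * hS ^ 3 - η * hS ^ 2 + c = 0) :
    hE < hS := by
  obtain ⟨hE0, hE1⟩ := hEmem
  obtain ⟨hS0, -⟩ := hSmem
  rw [lt_div_iff₀ (by positivity)] at hE1
  by_contra! hle
  have hEb : 3 * (g * ν) * hE < 2 * η := by linarith
  have hSb : 3 * (g * ν) * hS < 2 * η :=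
    (mul_le_mul_of_nonneg_left hle (by positivity)).trans_lt hEb
  have hslope : g * ν * (hE ^ 2 + hE * hS + hS ^ 2) - η * (hE + hS) ≤ 0 := by
    linarith [mul_lt_mul_of_pos_right hEb hE0, mul_lt_mul_of_pos_right hEb hS0,
      mul_lt_mul_of_pos_right hSb hE0, mul_lt_mul_of_pos_right hSb hS0]
  have hdecr := mul_nonpos_of_nonneg_of_nonpos (sub_nonneg.2 hle) hslope
  have hgap : 0 < g * (1 - ν) * hS ^ 3 := mul_pos (mul_pos hg (sub_pos.2 hν1)) (pow_pos hS0 3)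
  linarith
end

section
/- Let g > 0, 0 < ν ≤ 1, η > 0, c > 0, P^S(h) = g h³ − η h² + c and P^E(h) = g ν h³ − η h² + c. Suppose h^E ∈ (0, 2η/(3gν)) is a root of P^E, h^S ∈ (0, 2η/(3g)) is a root of P^S, and h^E ≤ h^S. Then there exists ξ ∈ [h^E, h^S] with 0 < ξ and ξ < 2η/(3g) such that h^S − h^E = (1 − ν)·(h^E)³ / (3·ξ·(2η/(3g) − ξ)). -/
/-- Closed-interval mean value theorem, allowing a degenerate interval, for the cubic
`g h³ − η h² + c`. -/
theorem exists_depth_cubic_sub_eq (g η c : ℝ) {a b : ℝ} (hab : a ≤ b) :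
    ∃ ξ ∈ Set.Icc a b, (g * b ^ 3 - η * b ^ 2 + c) - (g * a ^ 3 - η * a ^ 2 + c) =
      (3 * g * ξ ^ 2 - 2 * η * ξ) * (b - a) := by
  rcases hab.eq_or_lt with rfl | hlt
  · exact ⟨a, Set.left_mem_Icc.mpr le_rfl, by ring⟩
  have hderiv (x : ℝ) : HasDerivAt (fun h : ℝ => g * h ^ 3 - η * h ^ 2 + c)
      (3 * g * x ^ 2 - 2 * η * x) x := by
    refine ((((hasDerivAt_pow 3 x).const_mul g).sub
      ((hasDerivAt_pow 2 x).const_mul η)).add_const c).congr_deriv ?_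
    norm_num
    ring
  obtain ⟨ξ, hξ, h⟩ := exists_hasDerivAt_eq_slope _ _ hlt
    (fun x _ => (hderiv x).continuousAt.continuousWithinAt) (fun x _ => hderiv x)
  exact ⟨ξ, Set.Ioo_subset_Icc_self hξ, ((eq_div_iff (sub_pos.mpr hlt).ne').mp h).symm⟩

/-- Mean value identity for the difference of the water depths of the two
models: `h^S − h^E = (1 − ν)(h^E)³ / (3ξ(2η/(3g) − ξ))` for some
`ξ ∈ [h^E, h^S]`. -/
theorem depth_difference_mvt_identity_S (g ν η c hE hS : ℝ)
    (hg : 0 < g) (hν0 : 0 < ν) (hν1 : ν ≤ 1) (hη : 0 < η) (hc : 0 < c)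
    (hEmem : hE ∈ Set.Ioo (0 : ℝ) (2 * η / (3 * g * ν)))
    (hEroot : g * ν * hE ^ 3 - η * hE ^ 2 + c = 0)
    (hSmem : hS ∈ Set.Ioo (0 : ℝ) (2 * η / (3 * g)))
    (hSroot : g * hS ^ 3 - η * hS ^ 2 + c = 0)
    (hle : hE ≤ hS) :
    ∃ ξ ∈ Set.Icc hE hS, 0 < ξ ∧ ξ < 2 * η / (3 * g) ∧
      hS - hE = (1 - ν) * hE ^ 3 / (3 * ξ * (2 * η / (3 * g) - ξ)) := by
  obtain ⟨ξ, hξ, h⟩ := exists_depth_cubic_sub_eq g η c hle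
  have hpos : 0 < ξ := hEmem.1.trans_le hξ.1
  have hlt : ξ < 2 * η / (3 * g) := hξ.2.trans_lt hSmem.2
  refine ⟨ξ, hξ, hpos, hlt, ?_⟩
  have hgap : 0 < 2 * η / (3 * g) - ξ := sub_pos.mpr hlt
  rw [eq_div_iff (by positivity)]
  have hη_eq : 3 * g * (2 * η / (3 * g)) = 2 * η := by field_simp
  apply mul_left_cancel₀ hg.ne'
  linear_combination h - hSroot + hEroot + (hS - hE) * ξ * hη_eq
end

section
/- Let g > 0, 0 < ν ≤ 1, η > 0, c > 0, P^S(h) = g h³ − η h² + c and P^E(h) = g ν h³ − η h² + c. Suppose h^E ∈ (0, 2η/(3gν)) is a root of P^E, h^S ∈ (0, 2η/(3g)) is a root of P^S, h^E ≤ h^S, and suppose there are reals u₀, h₀ with u₀² > g·h₀ > 0 such that 2η/(3g) − h^S ≥ (u₀² − g·h₀)/(3g). Then h^S − h^E ≤ (1 − ν)·(h^E)²·g/(u₀² − g·h₀). -/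
/-- Statement (3) of the Proposition: upper bound
`h^S − h^E ≤ (1 − ν)(h^E)² g / (u₀² − g h₀)` for supercritical inflow data. -/
theorem depth_difference_upper_bound (g ν η c hE hS u₀ h₀ : ℝ)
    (hg : 0 < g) (hν0 : 0 < ν) (hν1 : ν ≤ 1) (hη : 0 < η) (hc : 0 < c)
    (hEmem : hE ∈ Set.Ioo (0 : ℝ) (2 * η / (3 * g * ν)))
    (hEroot : g * ν * hE ^ 3 - η * hE ^ 2 + c = 0)
    (hSmem : hS ∈ Set.Ioo (0 : ℝ) (2 * η / (3 * g)))
    (hSroot : g * hS ^ 3 - η * hS ^ 2 + c = 0)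
    (hle : hE ≤ hS)
    (hh₀ : 0 < g * h₀) (hsup : g * h₀ < u₀ ^ 2)
    (hdist : (u₀ ^ 2 - g * h₀) / (3 * g) ≤ 2 * η / (3 * g) - hS) :
    hS - hE ≤ (1 - ν) * hE ^ 2 * g / (u₀ ^ 2 - g * h₀) := by
  obtain ⟨hE0, -⟩ := hEmem
  have hd : 0 < u₀ ^ 2 - g * h₀ := sub_pos.mpr hsup
  have hslope : u₀ ^ 2 - g * h₀ ≤ 2 * η - 3 * g * hS := by
    have h : 2 * η / (3 * g) - hS = (2 * η - 3 * g * hS) / (3 * g) := by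
      field_simp
    rw [h] at hdist
    exact (div_le_div_iff_of_pos_right (by positivity)).mp hdist
  have hgap : 0 ≤ hS - hE := sub_nonneg.mpr hle
  have hη' : 0 ≤ η - g * (hS - hE) := by
    nlinarith [mul_pos hg hE0]
  have hbracket : hE * (u₀ ^ 2 - g * h₀) ≤
      η * (hS + hE) - g * (hS ^ 2 + hS * hE + hE ^ 2) := by
    linarith [mul_le_mul_of_nonneg_left hslope hE0.le, mul_nonneg hgap hη']
  rw [le_div_iff₀ hd]
  refine le_of_mul_le_mul_right ?_ hE0
  linarith [mul_le_mul_of_nonneg_left hbracket hgap]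
end

section
/- Let g > 0, 0 < ν ≤ 1, η > 0, c > 0, P^S(h) = g h³ − η h² + c and P^E(h) = g ν h³ − η h² + c. Suppose h^E ∈ (0, 2η/(3gν)) is a root of P^E, h^S ∈ (0, 2η/(3g)) is a root of P^S, and h^E ≤ h^S. Then there exists ξ ∈ [h^E, h^S] with 0 < ξ < 2η/(3gν) such that h^S − h^E = (1 − ν)·(h^S)³ / (3·ν·ξ·(2η/(3gν) − ξ)). -/
/-- Mean value theorem for the cubic `a x³ − b x²`, allowing a degenerate interval. -/
theorem exists_cubic_sub_eq_deriv_mul_sub (a b : ℝ) {x y : ℝ} (hxy : x ≤ y) :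
    ∃ ξ ∈ Set.Icc x y,
      (a * y ^ 3 - b * y ^ 2) - (a * x ^ 3 - b * x ^ 2) =
        (3 * a * ξ ^ 2 - 2 * b * ξ) * (y - x) := by
  rcases hxy.eq_or_lt with rfl | hlt
  · exact ⟨x, Set.left_mem_Icc.2 le_rfl, by ring⟩
  have hderiv (t : ℝ) :
      HasDerivAt (fun t => a * t ^ 3 - b * t ^ 2) (3 * a * t ^ 2 - 2 * b * t) t := by
    refine (((hasDerivAt_pow 3 t).const_mul a).sub
      ((hasDerivAt_pow 2 t).const_mul b)).congr_deriv ?_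
    norm_num
    ring
  obtain ⟨ξ, hξ, h⟩ := exists_hasDerivAt_eq_slope _ _ hlt
    (fun t _ => (hderiv t).continuousAt.continuousWithinAt) (fun t _ => hderiv t)
  exact ⟨ξ, Set.Ioo_subset_Icc_self hξ, ((eq_div_iff (sub_pos.2 hlt).ne').1 h).symm⟩

/-- Mean value identity for the difference of the water depths of the two
models: `h^S − h^E = (1 − ν)(h^S)³ / (3νξ(2η/(3gν) − ξ))` for some
`ξ ∈ [h^E, h^S]`. -/
theorem depth_difference_mvt_identity_E (g ν η c hE hS : ℝ)
    (hg : 0 < g) (hν0 : 0 < ν) (hν1 : ν ≤ 1) (hη : 0 < η) (hc : 0 < c)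
    (hEmem : hE ∈ Set.Ioo (0 : ℝ) (2 * η / (3 * g * ν)))
    (hEroot : g * ν * hE ^ 3 - η * hE ^ 2 + c = 0)
    (hSmem : hS ∈ Set.Ioo (0 : ℝ) (2 * η / (3 * g)))
    (hSroot : g * hS ^ 3 - η * hS ^ 2 + c = 0)
    (hle : hE ≤ hS) :
    ∃ ξ ∈ Set.Icc hE hS, 0 < ξ ∧ ξ < 2 * η / (3 * g * ν) ∧
      hS - hE = (1 - ν) * hS ^ 3 / (3 * ν * ξ * (2 * η / (3 * g * ν) - ξ)) := by
  obtain ⟨ξ, hξ, hmvt⟩ := exists_cubic_sub_eq_deriv_mul_sub (g * ν) η hle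
  have hξ0 : 0 < ξ := hEmem.1.trans_le hξ.1
  have hbound : 2 * η / (3 * g) ≤ 2 * η / (3 * g * ν) := by
    apply div_le_div_of_nonneg_left (by positivity) (by positivity)
    exact mul_le_of_le_one_right (by positivity) hν1
  have hξ1 : ξ < 2 * η / (3 * g * ν) := (hξ.2.trans_lt hSmem.2).trans_le hbound
  refine ⟨ξ, hξ, hξ0, hξ1, ?_⟩
  have hpos : 0 < 2 * η / (3 * g * ν) - ξ := sub_pos.2 hξ1
  have hη_eq : 3 * g * ν * (2 * η / (3 * g * ν)) = 2 * η := by field_simp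
  rw [eq_div_iff (by positivity)]
  apply mul_left_cancel₀ hg.ne'
  linear_combination (hS - hE) * ξ * hη_eq + hmvt + hEroot - hSroot
end

section
/- Let g > 0, 0 < ν ≤ 1, η > 0, q_w ≠ 0, r > 0, c = q_w²/(2r²), P^S(h) = g h³ − η h² + c, P^E(h) = g ν h³ − η h² + c, and h^Q = |q_w|/(r·√(2η)). Suppose h^E ∈ (0, 2η/(3gν)] is a root of P^E and h^S ∈ (0, 2η/(3g)] is a root of P^S. Then, with L := 1/(3ν·(2η/(3gν) − h^Q)), one has L > 0 and h^S − h^E ≥ L·(h^S)²·(1 − ν). -/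
/-- Statement (4) of the Proposition: lower bound
`h^S − h^E ≥ L (h^S)² (1 − ν)` with `L = 1/(3ν(2η/(3gν) − h^Q)) > 0`. -/
theorem depth_difference_lower_bound (g ν η q_w r hE hS : ℝ)
    (hg : 0 < g) (hν0 : 0 < ν) (hν1 : ν ≤ 1) (hη : 0 < η)
    (hq : q_w ≠ 0) (hr : 0 < r)
    (hEmem : hE ∈ Set.Ioc (0 : ℝ) (2 * η / (3 * g * ν)))
    (hEroot : g * ν * hE ^ 3 - η * hE ^ 2 + q_w ^ 2 / (2 * r ^ 2) = 0)
    (hSmem : hS ∈ Set.Ioc (0 : ℝ) (2 * η / (3 * g)))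
    (hSroot : g * hS ^ 3 - η * hS ^ 2 + q_w ^ 2 / (2 * r ^ 2) = 0) :
    0 < 1 / (3 * ν * (2 * η / (3 * g * ν) - |q_w| / (r * Real.sqrt (2 * η)))) ∧
    1 / (3 * ν * (2 * η / (3 * g * ν) - |q_w| / (r * Real.sqrt (2 * η)))) *
      hS ^ 2 * (1 - ν) ≤ hS - hE := by
  obtain ⟨hE0, hEle⟩ := hEmem
  obtain ⟨hS0, -⟩ := hSmem
  have hgν : 0 < g * ν := mul_pos hg hν0
  set Q := |q_w| / (r * Real.sqrt (2 * η)) with hQ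
  have hc : q_w ^ 2 / (2 * r ^ 2) = η * Q ^ 2 := by
    rw [hQ, div_pow, mul_pow, sq_abs, Real.sq_sqrt (by positivity)]
    field_simp
  rw [hc] at hEroot hSroot
  have hE' : 3 * (g * ν) * hE ≤ 2 * η := by
    rw [le_div_iff₀ (by positivity)] at hEle
    linarith
  have hQE : Q < hE := by
    have h3 : 0 < g * ν * hE ^ 3 := by positivity
    have h : Q ^ 2 < hE ^ 2 := lt_of_mul_lt_mul_left (by linarith) hη.le
    exact lt_of_pow_lt_pow_left₀ 2 hE0.le h
  have hden : 3 * ν * (2 * η / (3 * g * ν) - Q) = (2 * η - 3 * (g * ν) * Q) / g := by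
    field_simp
  have hpos : 0 < 2 * η - 3 * (g * ν) * Q := by
    have := mul_lt_mul_of_pos_left hQE hgν
    linarith
  have hfactor : g * hS ^ 3 * (1 - ν) =
      (hS - hE) * (η * (hS + hE) - g * ν * (hS ^ 2 + hS * hE + hE ^ 2)) := by
    linear_combination hSroot - hEroot
  have hlhs : 0 ≤ g * hS ^ 3 * (1 - ν) :=
    mul_nonneg (by positivity) (by linarith)
  have hES : hE ≤ hS := by
    by_contra! hlt
    have hbr : 0 < η * (hS + hE) - g * ν * (hS ^ 2 + hS * hE + hE ^ 2) := by
      have h1 := mul_le_mul_of_nonneg_right hE' (add_pos hS0 hE0).le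
      have h2 : 0 < g * ν * ((hE - hS) * (hE + 2 * hS)) :=
        mul_pos hgν (mul_pos (by linarith) (by linarith))
      linarith
    have := mul_neg_of_neg_of_pos (sub_neg.2 hlt) hbr
    linarith
  rw [hden, one_div_div]
  refine ⟨div_pos hg hpos, ?_⟩
  rw [div_mul_eq_mul_div, div_mul_eq_mul_div, div_le_iff₀ hpos]
  refine le_of_mul_le_mul_right ?_ hS0
  have hbr : 0 ≤ η * (hS - hE) + g * ν * (hS ^ 2 + hS * hE + hE ^ 2 - 3 * Q * hS) := by
    have h1 : 0 ≤ hS ^ 2 + hS * hE + hE ^ 2 - 3 * Q * hS := by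
      have := mul_lt_mul_of_pos_right hQE hS0
      linarith [sq_nonneg (hS - hE)]
    have h2 := mul_nonneg hη.le (sub_nonneg.2 hES)
    have h3 := mul_nonneg hgν.le h1
    linarith
  have := mul_nonneg (sub_nonneg.2 hES) hbr
  linarith
end

section
/- Let g > 0, h₀ > 0, u₀ with u₀² > g·h₀, and r₀ > 0. Let f : ℝ → ℝ be monotone nonincreasing on [r₀, r₁] (r₁ > r₀), and set q_w = r₀·h₀·u₀ with u₀ ≠ 0, q_e = (1/2)u₀² + g·(f(r₀) + h₀), and for r ∈ [r₀, r₁] define P^S_r(h) = g·h³ − (q_e − g·f(r))·h² + q_w²/(2r²). Then P^S_{r₀}(h₀) = 0, and for every r ∈ (r₀, r₁] one has P^S_r(h₀) < 0; consequently, for every r ∈ (r₀, r₁] there exists h^S(r) ∈ (0, h₀) with P^S_r(h^S(r)) = 0. -/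
/-- Existence part (1) of the Proposition for the standard model S-SWE:
with supercritical inflow data at `r₀` and a nonincreasing profile `f`,
the boundary datum `h₀` is a root of `P^S_{r₀}`, `P^S_r(h₀) < 0` for
`r ∈ (r₀, r₁]`, and hence `P^S_r` has a root `h^S(r) ∈ (0, h₀)` there. -/
theorem standard_model_root_existence
    (g h₀ u₀ r₀ r₁ : ℝ) (f : ℝ → ℝ)
    (hg : 0 < g) (hh₀ : 0 < h₀) (hsup : g * h₀ < u₀ ^ 2) (hu₀ : u₀ ≠ 0)
    (hr₀ : 0 < r₀) (hr₁ : r₀ < r₁)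
    (hf : AntitoneOn f (Set.Icc r₀ r₁)) :
    (g * h₀ ^ 3 -
        ((1 / 2) * u₀ ^ 2 + g * (f r₀ + h₀) - g * f r₀) * h₀ ^ 2 +
        (r₀ * h₀ * u₀) ^ 2 / (2 * r₀ ^ 2) = 0) ∧
    (∀ r ∈ Set.Ioc r₀ r₁,
      g * h₀ ^ 3 -
        ((1 / 2) * u₀ ^ 2 + g * (f r₀ + h₀) - g * f r) * h₀ ^ 2 +
        (r₀ * h₀ * u₀) ^ 2 / (2 * r ^ 2) < 0) ∧
    (∀ r ∈ Set.Ioc r₀ r₁, ∃ h ∈ Set.Ioo 0 h₀,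
      g * h ^ 3 -
        ((1 / 2) * u₀ ^ 2 + g * (f r₀ + h₀) - g * f r) * h ^ 2 +
        (r₀ * h₀ * u₀) ^ 2 / (2 * r ^ 2) = 0) := by
  have hneg : ∀ r ∈ Set.Ioc r₀ r₁,
      g * h₀ ^ 3 -
        ((1 / 2) * u₀ ^ 2 + g * (f r₀ + h₀) - g * f r) * h₀ ^ 2 +
        (r₀ * h₀ * u₀) ^ 2 / (2 * r ^ 2) < 0 := by
    rintro r ⟨hr, hr'⟩
    have hr_pos : 0 < r := hr₀.trans hr
    have hfr : f r ≤ f r₀ :=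
      hf (Set.left_mem_Icc.2 hr₁.le) ⟨hr.le, hr'⟩ hr.le
    have hgf : 0 ≤ g * (f r₀ - f r) := mul_nonneg hg.le (sub_nonneg.2 hfr)
    have hratio : r₀ ^ 2 / r ^ 2 < 1 := by
      rw [div_lt_one (by positivity)]
      gcongr
    have hu_sq : 0 < u₀ ^ 2 := by positivity
    have hkin : 0 < u₀ ^ 2 * (1 - r₀ ^ 2 / r ^ 2) :=
      mul_pos hu_sq (sub_pos.2 hratio)
    have hfactor : g * h₀ ^ 3 -
        ((1 / 2) * u₀ ^ 2 + g * (f r₀ + h₀) - g * f r) * h₀ ^ 2 +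
        (r₀ * h₀ * u₀) ^ 2 / (2 * r ^ 2) =
        -(h₀ ^ 2 * (u₀ ^ 2 * (1 - r₀ ^ 2 / r ^ 2) / 2 + g * (f r₀ - f r))) := by
      field_simp
      ring
    rw [hfactor, neg_lt_zero]
    positivity
  refine ⟨?_, hneg, fun r hr => ?_⟩
  · field_simp
    ring
  · have hr_pos : 0 < r := hr₀.trans hr.1
    have hzero : 0 < (r₀ * h₀ * u₀) ^ 2 / (2 * r ^ 2) := by positivity
    exact intermediate_value_Ioo' (f := fun h => g * h ^ 3 -
        ((1 / 2) * u₀ ^ 2 + g * (f r₀ + h₀) - g * f r) * h ^ 2 +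
        (r₀ * h₀ * u₀) ^ 2 / (2 * r ^ 2)) hh₀.le
      (Continuous.continuousOn (by fun_prop)) ⟨hneg r hr, by simpa using hzero⟩
end

section
/- Let g > 0, h₀ > 0, u₀ with u₀² > g·h₀, and r₀ > 0. Let f : ℝ → ℝ be monotone nonincreasing on [r₀, r₁] (r₁ > r₀), let ν : [r₀, r₁] → (0, 1] with ν(r₀) = 1, set q_w = r₀·h₀·u₀ with u₀ ≠ 0, q_e = (1/2)u₀² + g·(f(r₀) + h₀), and for r ∈ [r₀, r₁] define P^E_r(h) = g·ν(r)·h³ − (q_e − g·f(r))·h² + q_w²/(2r²). Then P^E_{r₀}(h₀) = 0, and for every r ∈ (r₀, r₁] one has P^E_r(h₀) < 0; consequently, for every r ∈ (r₀, r₁] there exists h^E(r) ∈ (0, h₀) with P^E_r(h^E(r)) = 0. -/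
/-- Existence part (1) of the Proposition for the extended model E-SWE:
with supercritical inflow data at `r₀` where `ν(r₀) = 1`, a nonincreasing
profile `f` and `ν(r) ∈ (0,1]`, the boundary datum `h₀` is a root of
`P^E_{r₀}`, `P^E_r(h₀) < 0` for `r ∈ (r₀, r₁]`, and hence `P^E_r` has a root
`h^E(r) ∈ (0, h₀)` there. -/
theorem extended_model_root_existence
    (g h₀ u₀ r₀ r₁ : ℝ) (f ν : ℝ → ℝ)
    (hg : 0 < g) (hh₀ : 0 < h₀) (hsup : g * h₀ < u₀ ^ 2) (hu₀ : u₀ ≠ 0)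
    (hr₀ : 0 < r₀) (hr₁ : r₀ < r₁)
    (hf : AntitoneOn f (Set.Icc r₀ r₁))
    (hν : ∀ r ∈ Set.Icc r₀ r₁, ν r ∈ Set.Ioc (0 : ℝ) 1)
    (hν₀ : ν r₀ = 1) :
    (g * ν r₀ * h₀ ^ 3 -
        ((1 / 2) * u₀ ^ 2 + g * (f r₀ + h₀) - g * f r₀) * h₀ ^ 2 +
        (r₀ * h₀ * u₀) ^ 2 / (2 * r₀ ^ 2) = 0) ∧
    (∀ r ∈ Set.Ioc r₀ r₁,
      g * ν r * h₀ ^ 3 -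
        ((1 / 2) * u₀ ^ 2 + g * (f r₀ + h₀) - g * f r) * h₀ ^ 2 +
        (r₀ * h₀ * u₀) ^ 2 / (2 * r ^ 2) < 0) ∧
    (∀ r ∈ Set.Ioc r₀ r₁, ∃ h ∈ Set.Ioo 0 h₀,
      g * ν r * h ^ 3 -
        ((1 / 2) * u₀ ^ 2 + g * (f r₀ + h₀) - g * f r) * h ^ 2 +
        (r₀ * h₀ * u₀) ^ 2 / (2 * r ^ 2) = 0) := by
  have hneg : ∀ r ∈ Set.Ioc r₀ r₁,
      g * ν r * h₀ ^ 3 -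
        ((1 / 2) * u₀ ^ 2 + g * (f r₀ + h₀) - g * f r) * h₀ ^ 2 +
        (r₀ * h₀ * u₀) ^ 2 / (2 * r ^ 2) < 0 := by
    intro r hr
    have hrpos : 0 < r := hr₀.trans hr.1
    have hrI : r ∈ Set.Icc r₀ r₁ := Set.Ioc_subset_Icc_self hr
    have hfr : f r ≤ f r₀ := hf (Set.left_mem_Icc.2 hr₁.le) hrI hr.1.le
    have hνr : ν r ≤ 1 := (hν r hrI).2
    have hratio : r₀ ^ 2 / r ^ 2 < 1 := by
      rw [div_lt_one (by positivity)]
      exact pow_lt_pow_left₀ hr.1 hr₀.le two_ne_zero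
    have hfactor : g * ν r * h₀ ^ 3 -
        ((1 / 2) * u₀ ^ 2 + g * (f r₀ + h₀) - g * f r) * h₀ ^ 2 +
        (r₀ * h₀ * u₀) ^ 2 / (2 * r ^ 2) =
        -(h₀ ^ 2 * (g * h₀ * (1 - ν r) + g * (f r₀ - f r) +
          u₀ ^ 2 / 2 * (1 - r₀ ^ 2 / r ^ 2))) := by
      field_simp
      ring
    have hnormal : 0 ≤ g * h₀ * (1 - ν r) := mul_nonneg (by positivity) (by linarith)
    have hprofile : 0 ≤ g * (f r₀ - f r) := mul_nonneg hg.le (by linarith)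
    have hkinetic : 0 < u₀ ^ 2 / 2 * (1 - r₀ ^ 2 / r ^ 2) :=
      mul_pos (by positivity) (by linarith)
    rw [hfactor, neg_lt_zero]
    exact mul_pos (by positivity) (by linarith)
  refine ⟨?_, hneg, fun r hr ↦ ?_⟩
  · rw [hν₀]
    field_simp
    ring
  · have hrpos : 0 < r := hr₀.trans hr.1
    have hcont : ContinuousOn (fun h : ℝ ↦ g * ν r * h ^ 3 -
        ((1 / 2) * u₀ ^ 2 + g * (f r₀ + h₀) - g * f r) * h ^ 2 +
        (r₀ * h₀ * u₀) ^ 2 / (2 * r ^ 2)) (Set.Icc 0 h₀) := by fun_prop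
    have hzero : 0 < g * ν r * (0 : ℝ) ^ 3 -
        ((1 / 2) * u₀ ^ 2 + g * (f r₀ + h₀) - g * f r) * (0 : ℝ) ^ 2 +
        (r₀ * h₀ * u₀) ^ 2 / (2 * r ^ 2) := by
      have : 0 < (r₀ * h₀ * u₀) ^ 2 / (2 * r ^ 2) := by positivity
      simpa using this
    exact intermediate_value_Ioo' hh₀.le hcont ⟨hneg r hr, hzero⟩
end

section
/- Let g > 0, h₀ > 0, u₀ with u₀² > g·h₀, r₀ > 0 and r > r₀. Let f be monotone nonincreasing on [r₀, r], let ν ∈ (0, 1], set q_w = r₀·h₀·u₀ (u₀ ≠ 0), q_e = (1/2)u₀² + g·(f(r₀) + h₀), η = q_e − g·f(r), P^S(h) = g·h³ − η·h² + q_w²/(2r²) and P^E(h) = g·ν·h³ − η·h² + q_w²/(2r²). Then h₀ < 2η/(3g), and if h^E ∈ (0, h₀) is a root of P^E and h^S ∈ (0, h₀) is a root of P^S, then h^E ≤ h^S < h₀. -/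
/-- A cubic `g h³ - η h² + c` is strictly decreasing on `[0, 2η/(3g)]`. -/
theorem cubic_strictAnti_below_critical {g η c a b : ℝ} (hg : 0 < g) (ha : 0 < a)
    (hab : a < b) (hb : 3 * g * b < 2 * η) :
    g * b ^ 3 - η * b ^ 2 + c < g * a ^ 3 - η * a ^ 2 + c := by
  have h_slope : g * (a ^ 2 + a * b + b ^ 2) < η * (a + b) := by
    have h_crit : 0 < (2 * η - 3 * g * b) * (a + b) := mul_pos (by linarith) (by linarith)
    have h_sq : 0 < g * ((b - a) * (b + 2 * a)) :=
      mul_pos hg (mul_pos (by linarith) (by linarith))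
    linarith
  have h_diff := mul_pos (sub_pos.mpr hab) (sub_pos.mpr h_slope)
  linarith


/-- Ordering `h^E ≤ h^S < h₀` from the proof of statement (2) of the
Proposition: with supercritical inflow data at `r₀`, nonincreasing profile `f`
and `η = q_e − g f(r)`, one has `h₀ < 2η/(3g)`, and any roots
`h^E ∈ (0, h₀)` of `P^E` and `h^S ∈ (0, h₀)` of `P^S` satisfy
`h^E ≤ h^S < h₀`. -/
theorem depth_ordering_below_inflow
    (g h₀ u₀ r₀ r ν : ℝ) (f : ℝ → ℝ)
    (hg : 0 < g) (hh₀ : 0 < h₀) (hsup : g * h₀ < u₀ ^ 2) (hu₀ : u₀ ≠ 0)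
    (hr₀ : 0 < r₀) (hr : r₀ < r)
    (hf : AntitoneOn f (Set.Icc r₀ r))
    (hν0 : 0 < ν) (hν1 : ν ≤ 1) :
    h₀ < 2 * ((1 / 2) * u₀ ^ 2 + g * (f r₀ + h₀) - g * f r) / (3 * g) ∧
    ∀ hE ∈ Set.Ioo 0 h₀, ∀ hS ∈ Set.Ioo 0 h₀,
      g * ν * hE ^ 3 -
        ((1 / 2) * u₀ ^ 2 + g * (f r₀ + h₀) - g * f r) * hE ^ 2 +
        (r₀ * h₀ * u₀) ^ 2 / (2 * r ^ 2) = 0 →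
      g * hS ^ 3 -
        ((1 / 2) * u₀ ^ 2 + g * (f r₀ + h₀) - g * f r) * hS ^ 2 +
        (r₀ * h₀ * u₀) ^ 2 / (2 * r ^ 2) = 0 →
      hE ≤ hS ∧ hS < h₀ := by
  have hmem₀ : r₀ ∈ Set.Icc r₀ r := ⟨le_rfl, hr.le⟩
  have hmem : r ∈ Set.Icc r₀ r := ⟨hr.le, le_rfl⟩
  have hfr : g * f r ≤ g * f r₀ := mul_le_mul_of_nonneg_left (hf hmem₀ hmem hr.le) hg.le
  refine ⟨by rw [lt_div_iff₀ (by positivity)]; linarith, ?_⟩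
  rintro hE ⟨hE_pos, hE_lt⟩ hS ⟨hS_pos, hS_lt⟩ rootE rootS
  refine ⟨?_, hS_lt⟩
  by_contra! hlt
  have hgE : g * hE < g * h₀ := mul_lt_mul_of_pos_left hE_lt hg
  have hanti := cubic_strictAnti_below_critical
    (η := (1 / 2) * u₀ ^ 2 + g * (f r₀ + h₀) - g * f r)
    (c := (r₀ * h₀ * u₀) ^ 2 / (2 * r ^ 2)) hg hS_pos hlt (by linarith)
  have hν : 0 ≤ (1 - ν) * (g * hE ^ 3) := mul_nonneg (by linarith) (by positivity)
  linarith
end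

section
/- Let g > 0, 0 < ν ≤ 1, η > 0, c > 0, P^S(h) = g h³ − η h² + c and P^E(h) = g ν h³ − η h² + c. Suppose h^E ∈ (0, 2η/(3gν)) is a root of P^E, h^S ∈ (0, 2η/(3g)) is a root of P^S, h^E ≤ h^S, and suppose there are reals u₀, h₀ with u₀² > g·h₀ > 0 such that 2η/(3g) − h^S ≥ (u₀² − g·h₀)/(3g). Then the relative error satisfies (h^S − h^E)/h^E ≤ (h^E/h₀)·(1 − ν)/(Fr² − 1), where Fr² := u₀²/(g·h₀). -/
/-- The relative error bound `(h^S − h^E)/h^E ≤ (h^E/h₀)(1 − ν)/(Fr² − 1)`,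
where `Fr² = u₀²/(g h₀)` is the squared Froude number of the inflow data. -/
theorem relative_error_upper_bound (g ν η c hE hS u₀ h₀ : ℝ)
    (hg : 0 < g) (hν0 : 0 < ν) (hν1 : ν ≤ 1) (hη : 0 < η) (hc : 0 < c)
    (hEmem : hE ∈ Set.Ioo (0 : ℝ) (2 * η / (3 * g * ν)))
    (hEroot : g * ν * hE ^ 3 - η * hE ^ 2 + c = 0)
    (hSmem : hS ∈ Set.Ioo (0 : ℝ) (2 * η / (3 * g)))
    (hSroot : g * hS ^ 3 - η * hS ^ 2 + c = 0)
    (hle : hE ≤ hS)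
    (hh₀ : 0 < g * h₀) (hsup : g * h₀ < u₀ ^ 2)
    (hdist : (u₀ ^ 2 - g * h₀) / (3 * g) ≤ 2 * η / (3 * g) - hS) :
    (hS - hE) / hE ≤ (hE / h₀) * (1 - ν) / (u₀ ^ 2 / (g * h₀) - 1) := by
  have hE0 : 0 < hE := hEmem.1
  have hh₀pos : 0 < h₀ := pos_of_mul_pos_right hh₀ hg.le
  have hD : 0 < u₀ ^ 2 - g * h₀ := sub_pos.mpr hsup
  have hd : 0 ≤ hS - hE := sub_nonneg.mpr hle
  have hDle : u₀ ^ 2 - g * h₀ ≤ 2 * η - 3 * g * hS := by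
    have key : 2 * η / (3 * g) - hS = (2 * η - 3 * g * hS) / (3 * g) := by field_simp
    rwa [key, div_le_div_iff_of_pos_right (by positivity)] at hdist
  have hgd : 0 ≤ η - g * (hS - hE) := by nlinarith [mul_pos hg hE0]
  have hident : g * (1 - ν) * hE ^ 2 * hE =
      (hS - hE) * (2 * η - 3 * g * hS) * hE + (hS - hE) ^ 2 * (η - g * (hS - hE)) := by
    linear_combination hSroot - hEroot
  have hbound : (hS - hE) * (2 * η - 3 * g * hS) ≤ g * (1 - ν) * hE ^ 2 := by
    refine le_of_mul_le_mul_right ?_ hE0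
    rw [hident]
    exact le_add_of_nonneg_right (mul_nonneg (sq_nonneg _) hgd)
  have hrhs : (hE / h₀) * (1 - ν) / (u₀ ^ 2 / (g * h₀) - 1) =
      g * (1 - ν) * hE / (u₀ ^ 2 - g * h₀) := by
    rw [div_sub_one hh₀.ne']
    field_simp
  rw [hrhs, div_le_div_iff₀ hE0 hD]
  calc (hS - hE) * (u₀ ^ 2 - g * h₀) ≤ (hS - hE) * (2 * η - 3 * g * hS) :=
        mul_le_mul_of_nonneg_left hDle hd
    _ ≤ g * (1 - ν) * hE ^ 2 := hbound
    _ = g * (1 - ν) * hE * hE := by ring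
end
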